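/- arXiv:2410.20187 — 4 statements merged into one kernel-verified Lean document; each statement's English description precedes it below -/
import Mathlib

section
/- Let Y be a nonempty finite type, let π_ref : Y → ℝ be a probability mass function with π_ref y > 0 for all y, let r : Y → ℝ and β > 0. Define the partition function Z = ∑_y π_ref y * exp(r y / β) and the Gibbs policy π* y = π_ref y * exp(r y / β) / Z. Then π* is a probability mass function with π* y > 0 for all y, and for every probability mass function π : Y → ℝ (π y ≥ 0, ∑_y π y = 1), one has ∑_y π y * r y − β * ∑_y π y * log (π y / π_ref y) ≤ β * log Z (with the convention 0 * log 0 = 0), with equality if and only if π = π*. In particular π* is the unique maximizer of the KL-regularized expected-reward objective. -/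
open InformationTheory in
/-- The Kullback-Leibler divergence of finite mass functions with equal total mass, written as a
sum of nonnegative terms. -/
theorem sum_mul_log_div_eq_sum_mul_klFun {ι : Type*} [Fintype ι] {p q : ι → ℝ}
    (hq : ∀ i, 0 < q i) (hpq : ∑ i, p i = ∑ i, q i) :
    ∑ i, p i * Real.log (p i / q i) = ∑ i, q i * klFun (p i / q i) := by
  have h : ∀ i, q i * klFun (p i / q i) = p i * Real.log (p i / q i) + (q i - p i) := by
    intro i
    have := (hq i).ne'
    rw [klFun_apply]
    field_simp
    ring
  simp_rw [h, Finset.sum_add_distrib, Finset.sum_sub_distrib, hpq, sub_self, add_zero]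

/-- Gibbs' inequality for finite mass functions. -/
theorem sum_mul_log_div_nonneg {ι : Type*} [Fintype ι] {p q : ι → ℝ}
    (hp : ∀ i, 0 ≤ p i) (hq : ∀ i, 0 < q i) (hpq : ∑ i, p i = ∑ i, q i) :
    0 ≤ ∑ i, p i * Real.log (p i / q i) := by
  rw [sum_mul_log_div_eq_sum_mul_klFun hq hpq]
  exact Finset.sum_nonneg fun i _ ↦
    mul_nonneg (hq i).le (InformationTheory.klFun_nonneg (div_nonneg (hp i) (hq i).le))

/-- The equality case of Gibbs' inequality for finite mass functions. -/
theorem sum_mul_log_div_eq_zero_iff {ι : Type*} [Fintype ι] {p q : ι → ℝ}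
    (hp : ∀ i, 0 ≤ p i) (hq : ∀ i, 0 < q i) (hpq : ∑ i, p i = ∑ i, q i) :
    ∑ i, p i * Real.log (p i / q i) = 0 ↔ p = q := by
  have hdiv i : 0 ≤ p i / q i := div_nonneg (hp i) (hq i).le
  rw [sum_mul_log_div_eq_sum_mul_klFun hq hpq, Finset.sum_eq_zero_iff_of_nonneg fun i _ ↦
    mul_nonneg (hq i).le (InformationTheory.klFun_nonneg (hdiv i)), funext_iff]
  refine ⟨fun h i ↦ ?_, fun h i _ ↦ ?_⟩
  · have := (mul_eq_zero.mp (h i (Finset.mem_univ i))).resolve_left (hq i).ne'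
    rwa [InformationTheory.klFun_eq_zero_iff (hdiv i), div_eq_one_iff_eq (hq i).ne'] at this
  · rw [h i, div_self (hq i).ne', InformationTheory.klFun_one, mul_zero]


/-- The Gibbs policy `πstar y = πref y * exp (r y / β) / Z` is a strictly positive
probability mass function, the KL-regularized expected-reward objective of any pmf `p`
is at most `β * log Z`, and equality holds iff `p = πstar`:
`πstar` is the unique maximizer of the KL-regularized expected-reward objective. -/
theorem gibbs_unique_maximizer {Y : Type*} [Fintype Y] [Nonempty Y]
    (πref : Y → ℝ) (href_pos : ∀ y, 0 < πref y) (href_sum : ∑ y, πref y = 1)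
    (r : Y → ℝ) (β : ℝ) (hβ : 0 < β)
    (Z : ℝ) (hZ : Z = ∑ y, πref y * Real.exp (r y / β))
    (πstar : Y → ℝ) (hπstar : ∀ y, πstar y = πref y * Real.exp (r y / β) / Z) :
    (∀ y, 0 < πstar y) ∧ (∑ y, πstar y = 1) ∧
    ∀ p : Y → ℝ, (∀ y, 0 ≤ p y) → (∑ y, p y = 1) →
      ((∑ y, p y * r y) - β * ∑ y, p y * Real.log (p y / πref y) ≤ β * Real.log Z) ∧
      (((∑ y, p y * r y) - β * ∑ y, p y * Real.log (p y / πref y) = β * Real.log Z) ↔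
        p = πstar) := by
  have hZ_pos : 0 < Z := by
    rw [hZ]
    exact Finset.sum_pos (fun y _ ↦ mul_pos (href_pos y) (Real.exp_pos _)) Finset.univ_nonempty
  have hpos y : 0 < πstar y := by
    rw [hπstar]
    exact div_pos (mul_pos (href_pos y) (Real.exp_pos _)) hZ_pos
  have hsum : ∑ y, πstar y = 1 := by
    simp_rw [hπstar]
    rw [← Finset.sum_div, ← hZ, div_self hZ_pos.ne']
  refine ⟨hpos, hsum, fun p hp hp_sum ↦ ?_⟩
  have hterm y : p y * r y - β * (p y * Real.log (p y / πref y)) =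
      p y * (β * Real.log Z) - β * (p y * Real.log (p y / πstar y)) := by
    rcases (hp y).eq_or_lt with h | h
    · simp [← h]
    · have hlog : Real.log (πstar y) = Real.log (πref y) + r y / β - Real.log Z := by
        rw [hπstar, Real.log_div (mul_pos (href_pos y) (Real.exp_pos _)).ne' hZ_pos.ne',
          Real.log_mul (href_pos y).ne' (Real.exp_pos _).ne', Real.log_exp]
      rw [Real.log_div h.ne' (href_pos y).ne', Real.log_div h.ne' (hpos y).ne', hlog]
      field_simp
      ring
  have hobj : (∑ y, p y * r y) - β * ∑ y, p y * Real.log (p y / πref y) =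
      β * Real.log Z - β * ∑ y, p y * Real.log (p y / πstar y) := by
    rw [Finset.mul_sum, Finset.mul_sum, ← Finset.sum_sub_distrib,
      Finset.sum_congr rfl fun y _ ↦ hterm y, Finset.sum_sub_distrib, ← Finset.sum_mul, hp_sum,
      one_mul]
  have hmass := hp_sum.trans hsum.symm
  rw [hobj]
  refine ⟨sub_le_self _ (mul_nonneg hβ.le (sum_mul_log_div_nonneg hp hpos hmass)), ?_⟩
  rw [sub_eq_self, mul_eq_zero, or_iff_right hβ.ne', sum_mul_log_div_eq_zero_iff hp hpos hmass]
end

section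
/- Let Y be a nonempty finite type, let π_ref : Y → ℝ be a probability mass function with π_ref y > 0 for all y, let r : Y → ℝ and β > 0. Define Z = ∑_y π_ref y * exp(r y / β), the Gibbs policy π* y = π_ref y * exp(r y / β) / Z, and the implicit reward r̂ y = β * log (π* y / π_ref y). Then r y = r̂ y + β * log Z for all y, and consequently the Bradley–Terry preference probability can be written purely in terms of the implicit rewards: for all y₁, y₂, σ(r y₁ − r y₂) = σ(r̂ y₁ − r̂ y₂), where σ(x) = 1 / (1 + exp(−x)) is the logistic sigmoid. (The partition function cancels.) -/
noncomputable def sigma (x : ℝ) : ℝ := 1 / (1 + Real.exp (-x))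

/-- The reward equals the implicit reward plus `β log Z`, hence the Bradley–Terry
preference probability can be written purely in terms of implicit rewards:
the partition function cancels. -/
theorem bradley_terry_implicit_reward {Y : Type*} [Fintype Y] [Nonempty Y]
    (πref : Y → ℝ) (href_pos : ∀ y, 0 < πref y) (href_sum : ∑ y, πref y = 1)
    (r : Y → ℝ) (β : ℝ) (hβ : 0 < β)
    (Z : ℝ) (hZ : Z = ∑ y, πref y * Real.exp (r y / β))
    (πstar : Y → ℝ) (hπstar : ∀ y, πstar y = πref y * Real.exp (r y / β) / Z)
    (rhat : Y → ℝ) (hrhat : ∀ y, rhat y = β * Real.log (πstar y / πref y)) :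
    (∀ y, r y = rhat y + β * Real.log Z) ∧
    ∀ y₁ y₂ : Y, sigma (r y₁ - r y₂) = sigma (rhat y₁ - rhat y₂) := by
  have hZ_pos : 0 < Z := by
    rw [hZ]
    exact Finset.sum_pos (fun y _ => mul_pos (href_pos y) (Real.exp_pos _)) Finset.univ_nonempty
  have hreward : ∀ y, r y = rhat y + β * Real.log Z := by
    intro y
    have hratio : πstar y / πref y = Real.exp (r y / β) / Z := by
      have := (href_pos y).ne'
      rw [hπstar]
      field_simp
    rw [hrhat, hratio, Real.log_div (Real.exp_pos _).ne' hZ_pos.ne', Real.log_exp]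
    field_simp
    ring
  refine ⟨hreward, fun y₁ y₂ => ?_⟩
  rw [hreward y₁, hreward y₂, add_sub_add_right_eq_sub]
end

section
/- Let Y be a nonempty finite type, let π_ref : Y → ℝ be a probability mass function with π_ref y > 0 for all y, let r : Y → ℝ, u : Y → ℝ and β > 0. Define Z_u = ∑_y π_ref y * exp((r y − u y) / β), the pessimistic Gibbs policy π*_u y = π_ref y * exp((r y − u y) / β) / Z_u, and the implicit reward r̂_u y = β * log (π*_u y / π_ref y). Then for all y₁, y₂, the Bradley–Terry preference probability satisfies σ(r y₁ − r y₂) = σ(r̂_u y₁ − r̂_u y₂ + (u y₁ − u y₂)), where σ(x) = 1 / (1 + exp(−x)) is the logistic sigmoid; i.e. the uncertainty penalization amounts to adding the margin Δ_u = u y₁ − u y₂ to the difference of implicit rewards. -/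
/-- Under the pessimistic Gibbs policy, the Bradley–Terry preference probability equals
the sigmoid of the difference of implicit rewards plus the uncertainty margin
`Δ_u = u y₁ − u y₂`. -/
theorem bradley_terry_pessimistic_margin {Y : Type*} [Fintype Y] [Nonempty Y]
    (πref : Y → ℝ) (href_pos : ∀ y, 0 < πref y) (href_sum : ∑ y, πref y = 1)
    (r u : Y → ℝ) (β : ℝ) (hβ : 0 < β)
    (Zu : ℝ) (hZu : Zu = ∑ y, πref y * Real.exp ((r y - u y) / β))
    (πstaru : Y → ℝ)
    (hπstaru : ∀ y, πstaru y = πref y * Real.exp ((r y - u y) / β) / Zu)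
    (rhatu : Y → ℝ) (hrhatu : ∀ y, rhatu y = β * Real.log (πstaru y / πref y)) :
    ∀ y₁ y₂ : Y,
      sigma (r y₁ - r y₂) = sigma (rhatu y₁ - rhatu y₂ + (u y₁ - u y₂)) := by
  have hZ : 0 < Zu := by
    rw [hZu]
    exact Finset.sum_pos (fun y _ => mul_pos (href_pos y) (Real.exp_pos _))
      Finset.univ_nonempty
  have key : ∀ y, rhatu y = r y - u y - β * Real.log Zu := by
    intro y
    have hratio : πstaru y / πref y = Real.exp ((r y - u y) / β) / Zu := by
      rw [hπstaru, mul_div_assoc, mul_div_cancel_left₀ _ (href_pos y).ne']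
    rw [hrhatu, hratio, Real.log_div (Real.exp_ne_zero _) hZ.ne', Real.log_exp, mul_sub,
      mul_div_cancel₀ _ hβ.ne']
  intro y₁ y₂
  rw [key, key]
  congr 1
  ring
end

section
/- Let E be a real normed vector space, let f, g : E → ℝ be functions differentiable at θ ∈ E with f θ > 0 and g θ > 0, let c_w, c_l > 0 and β ∈ ℝ. Define the per-sample DPO loss L : E → ℝ by L(θ') = −log (σ (β * log (f θ' / c_w) − β * log (g θ' / c_l))), where σ(x) = 1 / (1 + exp(−x)), and set ρ = β * log (f θ / c_w) − β * log (g θ / c_l). Then L is differentiable at θ and its Fréchet derivative satisfies fderiv L θ = −β * σ(−ρ) • ((1 / f θ) • fderiv f θ − (1 / g θ) • fderiv g θ). -/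
theorem hasDerivAt_neg_log_sigma (x : ℝ) :
    HasDerivAt (fun x => -Real.log (sigma x)) (-sigma (-x)) x := by
  have hpos : 0 < 1 + Real.exp (-x) := by positivity
  have hlog : (fun x => -Real.log (sigma x)) = fun x => Real.log (1 + Real.exp (-x)) := by
    funext y
    simp [sigma]
  rw [hlog]
  convert (((hasDerivAt_neg x).exp).const_add 1).log hpos.ne' using 1
  rw [sigma, neg_neg, Real.exp_neg]
  field_simp
  ring

theorem HasFDerivAt.log_div_const {E : Type*} [NormedAddCommGroup E] [NormedSpace ℝ E]
    {f : E → ℝ} {f' : E →L[ℝ] ℝ} {θ : E} (hf : HasFDerivAt f f' θ) (hfθ : f θ ≠ 0)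
    {c : ℝ} (hc : c ≠ 0) :
    HasFDerivAt (fun θ' => Real.log (f θ' / c)) ((1 / f θ) • f') θ := by
  have h : HasFDerivAt (fun θ' => f θ' / c) (c⁻¹ • f') θ := by
    simpa only [div_eq_mul_inv] using hf.mul_const c⁻¹
  convert h.log (div_ne_zero hfθ hc) using 1
  rw [smul_smul]
  congr 1
  field_simp

/-- The DPO loss gradient formula: the per-sample DPO loss
`L θ' = −log σ(β log (f θ'/c_w) − β log (g θ'/c_l))` is differentiable at `θ` with
Fréchet derivative `−β σ(−ρ) • ((1/f θ) • fderiv f θ − (1/g θ) • fderiv g θ)`. -/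
theorem dpo_loss_gradient {E : Type*} [NormedAddCommGroup E] [NormedSpace ℝ E]
    (f g : E → ℝ) (θ : E)
    (hf : DifferentiableAt ℝ f θ) (hg : DifferentiableAt ℝ g θ)
    (hfθ : 0 < f θ) (hgθ : 0 < g θ)
    (cw cl : ℝ) (hcw : 0 < cw) (hcl : 0 < cl) (β : ℝ)
    (L : E → ℝ)
    (hL : ∀ θ', L θ' =
      -Real.log (sigma (β * Real.log (f θ' / cw) - β * Real.log (g θ' / cl))))
    (ρ : ℝ) (hρ : ρ = β * Real.log (f θ / cw) - β * Real.log (g θ / cl)) :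
    HasFDerivAt L
      ((-(β * sigma (-ρ))) •
        ((1 / f θ) • fderiv ℝ f θ - (1 / g θ) • fderiv ℝ g θ)) θ := by
  obtain rfl : L = _ := funext hL
  subst hρ
  have hinner := ((hf.hasFDerivAt.log_div_const hfθ.ne' hcw.ne').const_mul β).sub
    ((hg.hasFDerivAt.log_div_const hgθ.ne' hcl.ne').const_mul β)
  refine ((hasDerivAt_neg_log_sigma _).comp_hasFDerivAt θ hinner).congr_fderiv ?_
  rw [← smul_sub, smul_smul]
  congr 1
  simp only [Pi.sub_apply]
  ring
end
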